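/- (Convex-hull form of Proposition 2, reverse direction.) Let d ≥ 1, Δ ∈ ℝ^d, W ∈ ℝ, and let v₁,…,v_m ∈ ℝ^d each satisfy the AWB condition Σ_i (v_k)↓_i Δ↑_i ≥ W. If λ ∈ ℝ^d lies in the convex hull of the set of all coordinate permutations of the vectors v₁,…,v_m, then λ also satisfies the AWB condition Σ_i λ↓_i Δ↑_i ≥ W. -/

import Mathlib

/-- The entries of `v` sorted in increasing order. -/
noncomputable def sortAsc {d : ℕ} (v : Fin d → ℝ) : Fin d → ℝ :=
  v ∘ Tuple.sort v

/-- The entries of `v` sorted in decreasing order. -/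
noncomputable def sortDesc {d : ℕ} (v : Fin d → ℝ) : Fin d → ℝ :=
  fun i => (v ∘ Tuple.sort v) i.rev

theorem antitone_sortDesc {d : ℕ} (v : Fin d → ℝ) : Antitone (sortDesc v) :=
  fun _ _ hij => Tuple.monotone_sort v (Fin.rev_le_rev.mpr hij)

/-- Rearrangement inequality: the AWB pairing is the least pairing over all permutations. -/
theorem sum_sortDesc_mul_sortAsc_le {d : ℕ} (v Δ : Fin d → ℝ) (σ : Equiv.Perm (Fin d)) :
    ∑ i, sortDesc v i * sortAsc Δ i ≤ ∑ i, v (σ i) * sortAsc Δ i := by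
  have hanti : Antivary (sortDesc v) (sortAsc Δ) :=
    (antitone_sortDesc v).antivary (Tuple.monotone_sort Δ)
  simpa [sortDesc] using hanti.sum_mul_le_sum_comp_perm_mul
    (σ := σ.trans ((Tuple.sort v).symm.trans Fin.revPerm))

/-- convex-hull form of Proposition 2, reverse direction: if each
`v k` satisfies the AWB condition and `λ` lies in the convex hull of all coordinate
permutations of the `v k`, then `λ` satisfies the AWB condition. -/
theorem stmt_7 (d : ℕ) (hd : 1 ≤ d) (Δ : Fin d → ℝ) (W : ℝ) (m : ℕ)
    (v : Fin m → Fin d → ℝ)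
    (hv : ∀ k : Fin m, ∑ i : Fin d, sortDesc (v k) i * sortAsc Δ i ≥ W)
    (lam : Fin d → ℝ)
    (hlam : lam ∈ convexHull ℝ
      {w : Fin d → ℝ | ∃ (k : Fin m) (π : Equiv.Perm (Fin d)), w = fun i => v k (π i)}) :
    ∑ i : Fin d, sortDesc lam i * sortAsc Δ i ≥ W := by
  let τ : Equiv.Perm (Fin d) := Fin.revPerm.trans (Tuple.sort lam)
  have hconv : Convex ℝ {w : Fin d → ℝ | W ≤ ∑ i, w (τ i) * sortAsc Δ i} := by
    refine convex_halfSpace_ge ⟨fun x y => ?_, fun c x => ?_⟩ W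
    · simp [add_mul, Finset.sum_add_distrib]
    · simp [Finset.mul_sum, mul_assoc]
  refine convexHull_min ?_ hconv hlam
  rintro _ ⟨k, π, rfl⟩
  exact (hv k).le.trans (sum_sortDesc_mul_sortAsc_le (v k) Δ (τ.trans π))
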